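/- arXiv:2203.10913 — 8 statements merged into one kernel-verified Lean document; each statement's English description precedes it below -/
import Mathlib

section
/- Let E be a complex vector space with finrank E = l, let F_1 ≤ F_2 ≤ … ≤ F_ω be a flag of subspaces with finrank F_α = j_α, let k ≤ l and let i_1, …, i_ω be natural numbers. Then the Schubert set {V : Submodule ℂ E | finrank V = k ∧ ∀ α, i_α ≤ finrank (V ⊓ F_α)} is nonempty if and only if i_α ≤ min(k, j_α) for every α. -/
open Module in
theorem Submodule.exists_finrank_eq_of_le {K E : Type*} [DivisionRing K] [AddCommGroup E]
    [Module K E] [FiniteDimensional K E] {A B : Submodule K E} (hAB : A ≤ B) {k : ℕ}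
    (hA : finrank K A ≤ k) (hB : k ≤ finrank K B) :
    ∃ V : Submodule K E, A ≤ V ∧ V ≤ B ∧ finrank K V = k := by
  induction k, hA using Nat.le_induction with
  | base => exact ⟨A, le_rfl, hAB, rfl⟩
  | succ k _ ih =>
    obtain ⟨V, hAV, hVB, hV⟩ := ih (by omega)
    have hlt : V < B := lt_of_le_of_ne hVB (by rintro rfl; omega)
    obtain ⟨x, hxB, hxV⟩ := SetLike.exists_of_lt hlt
    refine ⟨V ⊔ Submodule.span K {x}, hAV.trans le_sup_left,
      sup_le hVB ((Submodule.span_singleton_le_iff_mem x B).2 hxB), le_antisymm ?_ ?_⟩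
    · have h₁ := Submodule.finrank_add_le_finrank_add_finrank V (Submodule.span K {x})
      have h₂ := finrank_span_le_card (R := K) ({x} : Set E)
      simp only [Set.toFinset_singleton, Finset.card_singleton] at h₂
      omega
    · rw [← hV]
      exact Submodule.finrank_lt_finrank_of_lt <| lt_of_le_of_ne le_sup_left fun h =>
        hxV (h ▸ Submodule.mem_sup_right (Submodule.mem_span_singleton_self x))

open Module in
/-- In a finite flag, every dimension is attained by a subspace comparable to all its members. -/
theorem Submodule.exists_finrank_eq_forall_comparable {K E ι : Type*} [DivisionRing K]
    [AddCommGroup E] [Module K E] [FiniteDimensional K E] [LinearOrder ι] [Finite ι]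
    {F : ι → Submodule K E} (hF : Monotone F) {k : ℕ} (hk : k ≤ finrank K E) :
    ∃ V : Submodule K E, finrank K V = k ∧ ∀ α, F α ≤ V ∨ V ≤ F α := by
  obtain ⟨A, hA, hlow, hhigh⟩ : ∃ A : Submodule K E, finrank K A ≤ k ∧
      (∀ α, finrank K (F α) ≤ k → F α ≤ A) ∧ ∀ α, k < finrank K (F α) → A ≤ F α := by
    rcases Set.eq_empty_or_nonempty {α | finrank K (F α) ≤ k} with h | h
    · exact ⟨⊥, by simp, fun α hα => absurd hα (Set.eq_empty_iff_forall_notMem.1 h α),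
        fun _ _ => bot_le⟩
    · obtain ⟨a, ha, hmax⟩ := Set.exists_max_image _ id (Set.toFinite _) h
      refine ⟨F a, ha, fun α hα => hF (hmax α hα), fun α hα => hF ?_⟩
      by_contra! hlt
      exact hα.not_ge ((Submodule.finrank_mono (hF hlt.le)).trans ha)
  obtain ⟨B, hAB, hB, hBF⟩ : ∃ B : Submodule K E, A ≤ B ∧ k ≤ finrank K B ∧
      ∀ α, k < finrank K (F α) → B ≤ F α := by
    rcases Set.eq_empty_or_nonempty {α | k < finrank K (F α)} with h | h
    · exact ⟨⊤, le_top, by simpa using hk,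
        fun α hα => absurd hα (Set.eq_empty_iff_forall_notMem.1 h α)⟩
    · obtain ⟨b, hb, hmin⟩ := Set.exists_min_image _ id (Set.toFinite _) h
      exact ⟨F b, hhigh b hb, (Set.mem_ofPred.1 hb).le, fun α hα => hF (hmin α hα)⟩
  obtain ⟨V, hAV, hVB, hV⟩ := Submodule.exists_finrank_eq_of_le hAB hA hB
  exact ⟨V, hV, fun α => (le_or_gt (finrank K (F α)) k).imp
    (fun h => (hlow α h).trans hAV) fun h => hVB.trans (hBF α h)⟩

/-- A Schubert set is nonempty if and only if `i α ≤ min k (j α)` for every `α`. -/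
theorem schubert_set_nonempty_iff
    (E : Type*) [AddCommGroup E] [Module ℂ E] [FiniteDimensional ℂ E]
    (l k ν : ℕ) (hE : Module.finrank ℂ E = l) (hk : k ≤ l)
    (F : Fin ν → Submodule ℂ E) (hF : Monotone F)
    (j i : Fin ν → ℕ) (hj : ∀ α, Module.finrank ℂ ↥(F α) = j α) :
    (∃ V : Submodule ℂ E, Module.finrank ℂ ↥V = k ∧
        ∀ α, i α ≤ Module.finrank ℂ ↥(V ⊓ F α)) ↔
      ∀ α, i α ≤ min k (j α) := by
  constructor
  · rintro ⟨V, hV, h⟩ α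
    rw [← hV, ← hj α]
    exact (h α).trans
      (le_min (Submodule.finrank_mono inf_le_left) (Submodule.finrank_mono inf_le_right))
  · intro h
    obtain ⟨V, hV, hcomp⟩ := Submodule.exists_finrank_eq_forall_comparable hF (hk.trans hE.ge)
    refine ⟨V, hV, fun α => (h α).trans ?_⟩
    rcases hcomp α with hα | hα
    · rw [inf_eq_right.2 hα, hj]
      exact min_le_right _ _
    · rw [inf_eq_left.2 hα, hV]
      exact min_le_left _ _
end

section
/- Let E be a complex vector space with finrank E = l, let F_1 ≤ … ≤ F_ν be a flag of subspaces with finrank F_α = j_α and j_1 ≤ … ≤ j_ν ≤ l, let k ≤ l, and let c = (c_1, …, c_ν) be a tuple of natural numbers satisfying the weak conditions: c_1 ≤ … ≤ c_ν ≤ k, c_α ≤ j_α for all α, c_{α+1} − c_α ≤ j_{α+1} − j_α for all α < ν, and k − c_ν ≤ l − j_ν. Then there exists a subspace V of E with finrank V = k and finrank(V ⊓ F_α) = c_α exactly, for every α. In particular the open part Δ_c^0 of the corresponding Schubert variety is nonempty. -/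
theorem Submodule.exists_le_finrank_eq {K E : Type*} [DivisionRing K] [AddCommGroup E]
    [Module K E] (C : Submodule K E) {m : ℕ} (hm : m ≤ Module.finrank K C) :
    ∃ U ≤ C, Module.finrank K U = m := by
  obtain ⟨v, hv⟩ := exists_linearIndependent_of_le_finrank hm
  refine ⟨Submodule.span K (Set.range (C.subtype ∘ v)), ?_, ?_⟩
  · rw [Submodule.span_le]
    rintro _ ⟨i, rfl⟩
    exact (v i).2
  · rw [finrank_span_eq_card (hv.map' C.subtype C.ker_subtype), Fintype.card_fin]

/-- A subspace `W` of `A ≤ B` can be enlarged inside `B` by any dimension up to the codimension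
of `A` in `B` without changing its intersection with `A`. -/
theorem Submodule.exists_le_inf_eq_finrank_eq {K E : Type*} [DivisionRing K] [AddCommGroup E]
    [Module K E] [FiniteDimensional K E] {W A B : Submodule K E} (hWA : W ≤ A) (hAB : A ≤ B)
    {d : ℕ} (hd : Module.finrank K W ≤ d)
    (hdB : d - Module.finrank K W ≤ Module.finrank K B - Module.finrank K A) :
    ∃ V ≤ B, V ⊓ A = W ∧ Module.finrank K V = d := by
  obtain ⟨C, hAC, rfl⟩ := IsModularLattice.exists_disjoint_and_sup_eq hAB
  have hC := Submodule.finrank_sup_add_finrank_inf_eq A C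
  rw [hAC.eq_bot, finrank_bot] at hC
  obtain ⟨U, hUC, hU⟩ := C.exists_le_finrank_eq
    (m := d - Module.finrank K W) (by omega)
  have hAU : Disjoint A U := hAC.mono_right hUC
  refine ⟨W ⊔ U, sup_le_sup hWA hUC, ?_, ?_⟩
  · rw [sup_inf_assoc_of_le U hWA, inf_comm, hAU.eq_bot, sup_bot_eq]
  · have hV := Submodule.finrank_sup_add_finrank_inf_eq W U
    rw [(hAU.mono_left hWA).eq_bot, finrank_bot] at hV
    omega


/-- If the tuple `c` satisfies the weak conditions relative to `k`, the flag dimensions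
`j` and `l = finrank E`, then there is a `k`-dimensional subspace `V` whose intersection
with each flag member `F α` has dimension exactly `c α`: the open part `Δ_c⁰` of the
corresponding Schubert variety is nonempty. -/
theorem schubert_open_part_nonempty
    (E : Type*) [AddCommGroup E] [Module ℂ E] [FiniteDimensional ℂ E]
    (l k ν : ℕ) (hν : 0 < ν) (hE : Module.finrank ℂ E = l) (hk : k ≤ l)
    (F : Fin ν → Submodule ℂ E) (hF : Monotone F)
    (j : Fin ν → ℕ) (hj : ∀ α, Module.finrank ℂ ↥(F α) = j α)
    (hjmono : Monotone j) (hjl : ∀ α, j α ≤ l)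
    (c : Fin ν → ℕ)
    (hcmono : Monotone c)
    (hck : ∀ α, c α ≤ k)
    (hcj : ∀ α, c α ≤ j α)
    (hstep : ∀ (α : Fin ν) (h : (α : ℕ) + 1 < ν),
      c ⟨(α : ℕ) + 1, h⟩ - c α ≤ j ⟨(α : ℕ) + 1, h⟩ - j α)
    (hlast : k - c ⟨ν - 1, by omega⟩ ≤ l - j ⟨ν - 1, by omega⟩) :
    ∃ V : Submodule ℂ E, Module.finrank ℂ ↥V = k ∧
      ∀ α, Module.finrank ℂ ↥(V ⊓ F α) = c α := by
  have key : ∀ n (hn : n < ν), ∃ V ≤ F ⟨n, hn⟩,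
      ∀ α ≤ (⟨n, hn⟩ : Fin ν), Module.finrank ℂ ↥(V ⊓ F α) = c α := by
    intro n
    induction n with
    | zero =>
      intro hn
      obtain ⟨V, hV, hVc⟩ := (F ⟨0, hn⟩).exists_le_finrank_eq ((hcj ⟨0, hn⟩).trans_eq (hj _).symm)
      refine ⟨V, hV, fun α hα ↦ ?_⟩
      obtain rfl : α = ⟨0, hn⟩ := Fin.ext (Nat.le_zero.mp hα)
      rw [inf_eq_left.mpr hV, hVc]
    | succ n ih =>
      intro hn
      obtain ⟨W, hW, hWc⟩ := ih (by omega)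
      have hWn := hWc _ le_rfl
      rw [inf_eq_left.mpr hW] at hWn
      have hle : (⟨n, by omega⟩ : Fin ν) ≤ ⟨n + 1, hn⟩ := Nat.le_succ n
      obtain ⟨V, hV, hVW, hVc⟩ := Submodule.exists_le_inf_eq_finrank_eq hW (hF hle)
        (d := c ⟨n + 1, hn⟩) (hWn.trans_le (hcmono hle))
        (by rw [hWn, hj, hj]; exact hstep ⟨n, by omega⟩ hn)
      refine ⟨V, hV, fun α hα ↦ ?_⟩
      rcases hα.eq_or_lt with rfl | hα
      · rw [inf_eq_left.mpr hV, hVc]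
      · have hα' : α ≤ ⟨n, by omega⟩ := Nat.le_of_lt_succ hα
        rw [← hWc α hα', ← hVW, inf_assoc, inf_eq_right.mpr (hF hα')]
  obtain ⟨W, hW, hWc⟩ := key (ν - 1) (by omega)
  have hWn := hWc _ le_rfl
  rw [inf_eq_left.mpr hW] at hWn
  obtain ⟨V, -, hVW, hVk⟩ := Submodule.exists_le_inf_eq_finrank_eq hW le_top
    (d := k) (hWn.trans_le (hck _)) (by rw [hWn, hj, finrank_top, hE]; exact hlast)
  refine ⟨V, hVk, fun α ↦ ?_⟩
  have hα : α ≤ ⟨ν - 1, by omega⟩ := Nat.le_sub_one_of_lt α.2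
  rw [← hWc α hα, ← hVW, inf_assoc, inf_eq_right.mpr (hF hα)]
end

section
/- Let E be a complex vector space with finrank E = l, let F_1 ≤ … ≤ F_ν be a flag of subspaces with finrank F_α = j_α, let k ≤ l, and let c, c' be two tuples of natural numbers of length ν such that c' satisfies the weak conditions: c'_1 ≤ … ≤ c'_ν ≤ k, c'_α ≤ j_α for all α, c'_{α+1} − c'_α ≤ j_{α+1} − j_α for all α < ν, and k − c'_ν ≤ l − j_ν. Write Δ_c = {V : Submodule ℂ E | finrank V = k ∧ ∀ α, c_α ≤ finrank (V ⊓ F_α)} and likewise Δ_{c'}. Then Δ_{c'} ⊆ Δ_c if and only if c_α ≤ c'_α for every α. -/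
/-- A subspace `V` of `A` extends to a subspace of `B ≥ A` of any dimension up to
`finrank V + (finrank B - finrank A)` without enlarging its intersection with `A`. -/
theorem Submodule.exists_finrank_eq_inf_eq {K E : Type*} [DivisionRing K] [AddCommGroup E]
    [Module K E] [FiniteDimensional K E] {V A B : Submodule K E} (hVA : V ≤ A) (hAB : A ≤ B)
    {e : ℕ} (hVe : Module.finrank K V ≤ e)
    (he : e - Module.finrank K V ≤ Module.finrank K B - Module.finrank K A) :
    ∃ V' ≤ B, Module.finrank K V' = e ∧ V' ⊓ A = V := by
  obtain ⟨C, hC⟩ := exists_isCompl A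
  have hsup : A ⊔ C ⊓ B = B := by
    rw [← sup_inf_assoc_of_le C hAB, hC.sup_eq_top, top_inf_eq]
  have hinf : A ⊓ (C ⊓ B) = ⊥ := by rw [← inf_assoc, hC.inf_eq_bot, bot_inf_eq]
  have hdim := Submodule.finrank_sup_add_finrank_inf_eq A (C ⊓ B)
  rw [hsup, hinf, finrank_bot] at hdim
  obtain ⟨W, hW, hWdim⟩ : ∃ W ≤ C ⊓ B, Module.finrank K W = e - Module.finrank K V := by
    obtain ⟨f, hf⟩ := exists_linearIndependent_of_le_finrank
      (R := K) (M := ↥(C ⊓ B)) (n := e - Module.finrank K V) (by omega)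
    refine ⟨(Submodule.span K (Set.range f)).map (C ⊓ B).subtype, Submodule.map_subtype_le _ _, ?_⟩
    rw [Submodule.finrank_map_subtype_eq, finrank_span_eq_card hf, Fintype.card_fin]
  have hWA : W ⊓ A = ⊥ := by
    rw [eq_bot_iff, ← hinf, inf_comm]
    exact inf_le_inf_left A hW
  refine ⟨V ⊔ W, sup_le (hVA.trans hAB) (hW.trans inf_le_right), ?_, ?_⟩
  · have h := Submodule.finrank_sup_add_finrank_inf_eq V W
    have hVW : V ⊓ W = ⊥ := by
      rw [eq_bot_iff, ← hWA, inf_comm]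
      exact inf_le_inf_left W hVA
    rw [hVW, finrank_bot] at h
    omega
  · rw [sup_inf_assoc_of_le W hVA, hWA, sup_bot_eq]

/-- A subspace with prescribed dimensions of intersection with the terms of a flag. -/
theorem Submodule.exists_finrank_inf_eq {K E : Type*} [DivisionRing K] [AddCommGroup E]
    [Module K E] [FiniteDimensional K E] {G : ℕ → Submodule K E} (hG : Monotone G)
    {d : ℕ → ℕ} (hd : Monotone d) (h0 : d 0 ≤ Module.finrank K (G 0))
    (hstep : ∀ n, d (n + 1) - d n ≤ Module.finrank K (G (n + 1)) - Module.finrank K (G n))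
    (n : ℕ) : ∃ V ≤ G n, ∀ m ≤ n, Module.finrank K ↥(V ⊓ G m) = d m := by
  induction n with
  | zero =>
    obtain ⟨V, hV, hVd, -⟩ := Submodule.exists_finrank_eq_inf_eq (K := K) (E := E) (V := ⊥)
      (A := ⊥) (B := G 0) (e := d 0) le_rfl bot_le (by simp) (by simpa using h0)
    refine ⟨V, hV, fun m hm => ?_⟩
    obtain rfl : m = 0 := by omega
    rwa [inf_eq_left.mpr hV]
  | succ n ih =>
    obtain ⟨V, hV, hVd⟩ := ih
    have hVn : Module.finrank K V = d n := by
      rw [← hVd n le_rfl, inf_eq_left.mpr hV]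
    obtain ⟨V', hV', hVd', hinf⟩ := Submodule.exists_finrank_eq_inf_eq hV (hG n.le_succ)
      (hVn.trans_le (hd n.le_succ)) (by rw [hVn]; exact hstep n)
    refine ⟨V', hV', fun m hm => ?_⟩
    rcases hm.eq_or_lt with rfl | hm
    · rwa [inf_eq_left.mpr hV']
    · have hmn : m ≤ n := by omega
      rw [← hVd m hmn, ← hinf, inf_assoc, inf_eq_right.mpr (hG hmn)]


/-- Given two tuples `c`, `c'` with `c'` satisfying the weak conditions, the Schubert set
`Δ_{c'}` is contained in `Δ_c` if and only if `c α ≤ c' α` for every `α`. -/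
theorem schubert_inclusion_iff
    (E : Type*) [AddCommGroup E] [Module ℂ E] [FiniteDimensional ℂ E]
    (l k ν : ℕ) (hν : 0 < ν) (hE : Module.finrank ℂ E = l) (hk : k ≤ l)
    (F : Fin ν → Submodule ℂ E) (hF : Monotone F)
    (j : Fin ν → ℕ) (hj : ∀ α, Module.finrank ℂ ↥(F α) = j α)
    (c c' : Fin ν → ℕ)
    (h'mono : Monotone c')
    (h'k : ∀ α, c' α ≤ k)
    (h'j : ∀ α, c' α ≤ j α)
    (h'step : ∀ (α : Fin ν) (h : (α : ℕ) + 1 < ν),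
      c' ⟨(α : ℕ) + 1, h⟩ - c' α ≤ j ⟨(α : ℕ) + 1, h⟩ - j α)
    (h'last : k - c' ⟨ν - 1, by omega⟩ ≤ l - j ⟨ν - 1, by omega⟩) :
    ({V : Submodule ℂ E | Module.finrank ℂ ↥V = k ∧
        ∀ α, c' α ≤ Module.finrank ℂ ↥(V ⊓ F α)} ⊆
      {V : Submodule ℂ E | Module.finrank ℂ ↥V = k ∧
        ∀ α, c α ≤ Module.finrank ℂ ↥(V ⊓ F α)}) ↔
      ∀ α, c α ≤ c' α := by
  refine ⟨fun hsub => ?_, fun hcc V hV => ⟨hV.1, fun α => (hcc α).trans (hV.2 α)⟩⟩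
  let G : ℕ → Submodule ℂ E := fun i => if h : i < ν then F ⟨i, h⟩ else ⊤
  let d : ℕ → ℕ := fun i => if h : i < ν then c' ⟨i, h⟩ else k
  have hGF (α : Fin ν) : G α = F α := dif_pos α.2
  have hdc (α : Fin ν) : d α = c' α := dif_pos α.2
  have hGtop {i : ℕ} (hi : ν ≤ i) : G i = ⊤ := dif_neg hi.not_gt
  have hdk {i : ℕ} (hi : ν ≤ i) : d i = k := dif_neg hi.not_gt
  have hG : Monotone G := by
    intro a b hab
    rcases lt_or_ge b ν with hb | hb
    · rw [hGF ⟨a, hab.trans_lt hb⟩, hGF ⟨b, hb⟩]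
      exact hF hab
    · rw [hGtop hb]
      exact le_top
  have hd : Monotone d := by
    intro a b hab
    rcases lt_or_ge b ν with hb | hb
    · rw [hdc ⟨a, hab.trans_lt hb⟩, hdc ⟨b, hb⟩]
      exact h'mono hab
    · rw [hdk hb]
      rcases lt_or_ge a ν with ha | ha
      · rw [hdc ⟨a, ha⟩]
        exact h'k _
      · rw [hdk ha]
  have h0 : d 0 ≤ Module.finrank ℂ (G 0) := by
    rw [hdc ⟨0, hν⟩, hGF ⟨0, hν⟩, hj]
    exact h'j _
  have hstep (n : ℕ) :
      d (n + 1) - d n ≤ Module.finrank ℂ (G (n + 1)) - Module.finrank ℂ (G n) := by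
    rcases lt_trichotomy (n + 1) ν with hn | hn | hn
    · rw [hdc ⟨n + 1, hn⟩, hdc ⟨n, by omega⟩, hGF ⟨n + 1, hn⟩, hGF ⟨n, by omega⟩, hj, hj]
      exact h'step ⟨n, by omega⟩ hn
    · subst hn
      rw [hdk le_rfl, hdc ⟨n, by omega⟩, hGtop le_rfl, hGF ⟨n, by omega⟩, finrank_top, hE, hj]
      exact h'last
    · rw [hdk (by omega), hdk (by omega)]
      omega
  obtain ⟨V, -, hV⟩ := Submodule.exists_finrank_inf_eq hG hd h0 hstep ν
  have hVF (α : Fin ν) : Module.finrank ℂ ↥(V ⊓ F α) = c' α := by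
    rw [← hGF, hV α α.2.le, hdc]
  have hVk : Module.finrank ℂ V = k := by
    rw [← hdk le_rfl, ← hV ν le_rfl, hGtop le_rfl, inf_top_eq]
  intro α
  rw [← hVF α]
  exact (hsub ⟨hVk, fun β => (hVF β).ge⟩).2 α
end

section
/- Let E be a finite-dimensional complex vector space, let F_1 ≤ … ≤ F_ν be a flag of subspaces of E, and let k, c_1, …, c_ν be natural numbers. Let Δ^0 = {V : Submodule ℂ E | finrank V = k ∧ ∀ α, finrank(V ⊓ F_α) = c_α} and let T = {(Z_1, …, Z_ν, V) | Z_1 ≤ Z_2 ≤ … ≤ Z_ν ≤ V, Z_α ≤ F_α and finrank Z_α = c_α for all α, finrank V = k, and finrank(V ⊓ F_α) = c_α for all α}. Then the projection (Z_1, …, Z_ν, V) ↦ V is a bijection from T onto Δ^0; its inverse sends V to (V ⊓ F_1, …, V ⊓ F_ν, V). In particular, over Δ^0 the fibre of the resolution π is a single point. -/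
/-- Over the open stratum `Δ⁰` where all intersection dimensions are exactly `c α`, the
projection `(Z₁, …, Z_ν, V) ↦ V` from the incidence set `T` is a bijection onto `Δ⁰`,
whose inverse sends `V` to `(V ⊓ F₁, …, V ⊓ F_ν, V)`: the fibre of the resolution `π`
over `Δ⁰` is a single point. -/
theorem resolution_bijective_over_open_stratum
    (E : Type*) [AddCommGroup E] [Module ℂ E] [FiniteDimensional ℂ E]
    (ν k : ℕ) (F : Fin ν → Submodule ℂ E) (hF : Monotone F) (c : Fin ν → ℕ) :
    let Δ0 : Set (Submodule ℂ E) :=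
      {V | Module.finrank ℂ ↥V = k ∧ ∀ α, Module.finrank ℂ ↥(V ⊓ F α) = c α}
    let T : Set ((Fin ν → Submodule ℂ E) × Submodule ℂ E) :=
      {Zv | Monotone Zv.1 ∧ (∀ α, Zv.1 α ≤ Zv.2) ∧ (∀ α, Zv.1 α ≤ F α) ∧
        (∀ α, Module.finrank ℂ ↥(Zv.1 α) = c α) ∧ Module.finrank ℂ ↥Zv.2 = k ∧
        (∀ α, Module.finrank ℂ ↥(Zv.2 ⊓ F α) = c α)}
    Set.BijOn (fun Zv : (Fin ν → Submodule ℂ E) × Submodule ℂ E => Zv.2) T Δ0 ∧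
      ∀ Zv ∈ T, Zv.1 = fun α => Zv.2 ⊓ F α := by
  intro Δ0 T
  have key : ∀ Zv ∈ T, Zv.1 = fun α => Zv.2 ⊓ F α := by
    rintro ⟨Z, V⟩ ⟨-, hZV, hZF, hZ, -, hV⟩
    funext α
    exact Submodule.eq_of_le_of_finrank_eq (le_inf (hZV α) (hZF α)) ((hZ α).trans (hV α).symm)
  refine ⟨⟨?_, ?_, ?_⟩, key⟩
  · rintro Zv ⟨-, -, -, -, hk, hV⟩
    exact ⟨hk, hV⟩
  · intro P hP Q hQ h
    have h' : P.2 = Q.2 := h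
    refine Prod.ext ?_ h'
    rw [key P hP, key Q hQ, h']
  · rintro V ⟨hk, hV⟩
    exact ⟨(fun α => V ⊓ F α, V), ⟨fun _ _ hab => inf_le_inf_left V (hF hab),
      fun _ => inf_le_left, fun _ => inf_le_right, hV, hk, hV⟩, rfl⟩
end

section
/- Let E be a finite-dimensional complex vector space, let F_1 ≤ … ≤ F_ν be a flag of subspaces of E, let c_1 ≤ c_2 ≤ … ≤ c_ν be natural numbers, and let V be a subspace of E with c_α ≤ finrank(V ⊓ F_α) for every α. Then there exists a chain of subspaces Z_1 ≤ Z_2 ≤ … ≤ Z_ν ≤ V with Z_α ≤ F_α and finrank Z_α = c_α for every α. In particular, the projection (Z_1,…,Z_ν,V) ↦ V from the incidence set onto the Schubert set {V | finrank V = k ∧ ∀ α, c_α ≤ finrank(V ⊓ F_α)} is surjective. -/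
/-- Between two nested subspaces there is a subspace of every intermediate dimension. -/
theorem Submodule.exists_le_le_finrank_eq {K E : Type*} [DivisionRing K] [AddCommGroup E]
    [Module K E] [FiniteDimensional K E] {A B : Submodule K E} (hAB : A ≤ B) {n : ℕ}
    (hA : Module.finrank K A ≤ n) (hB : n ≤ Module.finrank K B) :
    ∃ Z : Submodule K E, A ≤ Z ∧ Z ≤ B ∧ Module.finrank K Z = n := by
  induction n, hA using Nat.le_induction with
  | base => exact ⟨A, le_rfl, hAB, rfl⟩
  | succ n _ ih =>
    obtain ⟨Z, hAZ, hZB, hZ⟩ := ih (by lia)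
    have hne : Z ≠ B := by
      rintro rfl
      lia
    obtain ⟨x, hxB, hxZ⟩ := SetLike.exists_of_lt (lt_of_le_of_ne hZB hne)
    refine ⟨Z ⊔ K ∙ x, hAZ.trans le_sup_left,
      sup_le hZB ((Submodule.span_singleton_le_iff_mem x B).2 hxB), le_antisymm ?_ ?_⟩
    · have h₁ := Submodule.finrank_add_le_finrank_add_finrank Z (K ∙ x)
      have h₂ := finrank_span_le_card (R := K) ({x} : Set E)
      simp only [Set.toFinset_singleton, Finset.card_singleton] at h₂
      lia
    · have hlt : Z < Z ⊔ K ∙ x := left_lt_sup.2 fun h =>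
        hxZ (h (Submodule.mem_span_singleton_self x))
      have := Submodule.finrank_lt_finrank_of_lt hlt
      lia

/-- A chain of subspaces `W` containing `A` has a chain of subspaces `Z i` with
`A ≤ Z i ≤ W i` of any prescribed monotone dimensions between those of `A` and `W i`. -/
theorem Submodule.exists_monotone_finrank_eq {K E : Type*} [DivisionRing K] [AddCommGroup E]
    [Module K E] [FiniteDimensional K E] {n : ℕ} {W : Fin n → Submodule K E} (hW : Monotone W)
    {c : Fin n → ℕ} (hc : Monotone c) (hcW : ∀ i, c i ≤ Module.finrank K (W i))
    {A : Submodule K E} (hA : ∀ i, A ≤ W i) (hAc : ∀ i, Module.finrank K A ≤ c i) :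
    ∃ Z : Fin n → Submodule K E, Monotone Z ∧
      ∀ i, A ≤ Z i ∧ Z i ≤ W i ∧ Module.finrank K (Z i) = c i := by
  induction n generalizing A with
  | zero => exact ⟨W, hW, fun i => i.elim0⟩
  | succ n ih =>
    obtain ⟨Z₀, hAZ₀, hZ₀W, hZ₀⟩ := exists_le_le_finrank_eq (hA 0) (hAc 0) (hcW 0)
    obtain ⟨Z, hZmono, hZ⟩ := ih (W := fun i => W i.succ) (c := fun i => c i.succ) (A := Z₀)
      (fun i j h => hW (Fin.succ_le_succ_iff.2 h)) (fun i j h => hc (Fin.succ_le_succ_iff.2 h))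
      (fun i => hcW i.succ) (fun i => hZ₀W.trans (hW (Fin.zero_le _)))
      (fun i => hZ₀.le.trans (hc (Fin.zero_le _)))
    refine ⟨Fin.cons Z₀ Z, ?_, Fin.cases ⟨hAZ₀, hZ₀W, hZ₀⟩ fun i =>
      ⟨hAZ₀.trans (hZ i).1, (hZ i).2⟩⟩
    intro i j hij
    cases i using Fin.cases with
    | zero =>
      cases j using Fin.cases with
      | zero => exact le_rfl
      | succ j => exact (hZ j).1
    | succ i =>
      cases j using Fin.cases with
      | zero => exact absurd hij (Fin.succ_pos i).not_ge
      | succ j => exact hZmono (Fin.succ_le_succ_iff.1 hij)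

/-- Given a flag `F₁ ≤ … ≤ F_ν`, a monotone tuple `c` and a subspace `V` with
`c α ≤ finrank (V ⊓ F α)` for every `α`, there is a chain `Z₁ ≤ … ≤ Z_ν ≤ V` with
`Z α ≤ F α` and `finrank (Z α) = c α`: the projection of the incidence set onto the
Schubert set is surjective. -/
theorem resolution_surjective
    (E : Type*) [AddCommGroup E] [Module ℂ E] [FiniteDimensional ℂ E]
    (ν : ℕ) (F : Fin ν → Submodule ℂ E) (hF : Monotone F)
    (c : Fin ν → ℕ) (hc : Monotone c)
    (V : Submodule ℂ E) (hV : ∀ α, c α ≤ Module.finrank ℂ ↥(V ⊓ F α)) :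
    ∃ Z : Fin ν → Submodule ℂ E, Monotone Z ∧ (∀ α, Z α ≤ V) ∧
      (∀ α, Z α ≤ F α) ∧ ∀ α, Module.finrank ℂ ↥(Z α) = c α := by
  obtain ⟨Z, hZmono, hZ⟩ := Submodule.exists_monotone_finrank_eq (W := fun α => V ⊓ F α)
    (fun _ _ h => inf_le_inf_left V (hF h)) hc hV (A := ⊥) (fun _ => bot_le) (by simp)
  exact ⟨Z, hZmono, fun α => (hZ α).2.1.trans inf_le_left,
    fun α => (hZ α).2.1.trans inf_le_right, fun α => (hZ α).2.2⟩
end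

section
/- Let ν ≥ 1 and let k, l and i_β, j_β, p_β, ε_β (β = 1, …, ν) be integers. With the conventions i_0 + p_0 := 0, ε_0 := 0, and c_{ν+1} := 0, where c_β := l − k − j_β + i_β + p_β, the following identity holds: Σ_{β=1}^{ν} ((i_β + p_β + ε_β) − (i_{β−1} + p_{β−1} + ε_{β−1}))·(c_β + ε_β) − Σ_{β=1}^{ν} ((i_β + p_β) − (i_{β−1} + p_{β−1}))·c_β = Σ_{β=1}^{ν} ε_β·((i_β + p_β) − (i_{β−1} + p_{β−1}) + c_β − c_{β+1}) + B(ε), where B(ε) := ε_ν² + Σ_{β=1}^{ν−1} (ε_β² − ε_β ε_{β+1}). (This is the combinatorial form of Zelevinsky's formula m_{pq} = Σ_α ε_α(ι_α − ι_{α−1} + λ_{ι_α} − λ_{ι_{α+1}}) + B(ε) for the codimension of a Schubert subvariety Δ_q in Δ_p with q = p + ε.) -/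
/-- Summation by parts: the difference of the two areas, up to a boundary term
`ε (n + 1) * c (n + 2)`. -/
theorem sum_Icc_area_sub_eq (n : ℕ) (a ε c : ℕ → ℤ) (hε0 : ε 0 = 0) :
    (∑ β ∈ Finset.Icc 1 (n + 1), ((a β + ε β) - (a (β - 1) + ε (β - 1))) * (c β + ε β))
      - ∑ β ∈ Finset.Icc 1 (n + 1), (a β - a (β - 1)) * c β
    = (∑ β ∈ Finset.Icc 1 (n + 1), ε β * (a β - a (β - 1) + c β - c (β + 1)))
      + ((ε (n + 1)) ^ 2 + ∑ β ∈ Finset.Icc 1 n, ((ε β) ^ 2 - ε β * ε (β + 1)))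
      + ε (n + 1) * c (n + 2) := by
  induction n with
  | zero =>
    simp [hε0]
    ring
  | succ n ih =>
    simp only [Finset.sum_Icc_succ_top (Nat.le_add_left 1 (n + 1)), Nat.add_sub_cancel] at ih ⊢
    rw [Finset.sum_Icc_succ_top (Nat.le_add_left 1 n) fun β => ε β ^ 2 - ε β * ε (β + 1)]
    linear_combination ih

/-- The combinatorial form of Zelevinsky's codimension formula
`m_{pq} = Σ_β ε_β (ι_β - ι_{β-1} + λ_{ι_β} - λ_{ι_{β+1}}) + B(ε)`, with the conventions
`i_0 + p_0 = 0`, `ε_0 = 0`, `c_{ν+1} = 0` and `c_β = l - k - j_β + i_β + p_β`. -/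
theorem zelevinsky_codimension_identity
    (ν : ℕ) (hν : 1 ≤ ν) (k l : ℤ) (i j p ε c : ℕ → ℤ)
    (hi0 : i 0 + p 0 = 0) (hε0 : ε 0 = 0)
    (hc : ∀ β, 1 ≤ β → β ≤ ν → c β = l - k - j β + i β + p β)
    (hcend : c (ν + 1) = 0) :
    (∑ β ∈ Finset.Icc 1 ν,
        ((i β + p β + ε β) - (i (β - 1) + p (β - 1) + ε (β - 1))) * (c β + ε β))
      - ∑ β ∈ Finset.Icc 1 ν, ((i β + p β) - (i (β - 1) + p (β - 1))) * c β
    = (∑ β ∈ Finset.Icc 1 ν,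
        ε β * ((i β + p β) - (i (β - 1) + p (β - 1)) + c β - c (β + 1)))
      + ((ε ν) ^ 2 + ∑ β ∈ Finset.Icc 1 (ν - 1), ((ε β) ^ 2 - ε β * ε (β + 1))) := by
  obtain ⟨n, rfl⟩ := Nat.exists_eq_add_of_le' hν
  simpa [hcend] using sum_Icc_area_sub_eq n (fun β => i β + p β) ε c hε0
end

section
/- Let ν ≥ 1, let ι_1 < ι_2 < … < ι_ν be natural numbers with ι_0 := 0, and let λ_1 ≥ λ_2 ≥ … ≥ λ_ν ≥ 0 be natural numbers with λ_{ν+1} := 0. For ε = (ε_1, …, ε_ν) a tuple of natural numbers define m(ε) := Σ_{β=1}^{ν} ε_β (ι_β − ι_{β−1} + λ_β − λ_{β+1}) + B(ε), where B(ε) := ε_ν² + Σ_{β=1}^{ν−1}(ε_β² − ε_β ε_{β+1}), and dG(ε) := Σ_{β=1}^{ν} ε_β (λ_β − λ_{β+1}). Then 2·dG(ε) < m(ε) holds for every nonzero tuple ε of natural numbers if and only if λ_β − λ_{β+1} ≤ ι_β − ι_{β−1} for every β = 1, …, ν. (This is the combinatorial criterion for smallness of the resolution ξ_p: m(ε) is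 the codimension of the stratum Δ_{p+ε} in Δ_p and dG(ε) is the dimension of the fibre G of ξ_p over it.) -/
theorem sq_le_two_mul_chainForm (x : ℕ → ℤ) (n : ℕ) :
    x (n + 1) ^ 2 ≤
      2 * (x (n + 1) ^ 2 + ∑ β ∈ Finset.Icc 1 n, (x β ^ 2 - x β * x (β + 1))) := by
  induction n with
  | zero =>
    simp only [zero_add, zero_lt_one, Finset.Icc_eq_empty_of_lt, Finset.sum_empty, add_zero]
    nlinarith [sq_nonneg (x 1)]
  | succ n ih =>
    rw [Finset.sum_Icc_succ_top (by omega)]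
    nlinarith [sq_nonneg (x (n + 1) - x (n + 1 + 1))]

theorem sq_lt_two_mul_chainForm (x : ℕ → ℤ) (n : ℕ)
    (hx : ∃ β, 1 ≤ β ∧ β ≤ n + 1 ∧ x β ≠ 0) :
    x (n + 1) ^ 2 <
      2 * (x (n + 1) ^ 2 + ∑ β ∈ Finset.Icc 1 n, (x β ^ 2 - x β * x (β + 1))) := by
  induction n with
  | zero =>
    obtain ⟨β, h1, h2, hβ⟩ := hx
    obtain rfl : β = 1 := by omega
    have := pow_pos (abs_pos.mpr hβ) 2
    rw [sq_abs] at this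
    simp only [zero_add, zero_lt_one, Finset.Icc_eq_empty_of_lt, Finset.sum_empty, add_zero]
    linarith
  | succ n ih =>
    rw [Finset.sum_Icc_succ_top (by omega)]
    by_cases h : ∃ β, 1 ≤ β ∧ β ≤ n + 1 ∧ x β ≠ 0
    · nlinarith [sq_nonneg (x (n + 1) - x (n + 1 + 1)), ih h]
    · have h0 : x (n + 1) = 0 := by
        by_contra h'
        exact h ⟨n + 1, by omega, le_rfl, h'⟩
      obtain ⟨β, h1, h2, hβ⟩ := hx
      obtain rfl : β = n + 1 + 1 := by
        by_contra h'
        exact h ⟨β, h1, by omega, hβ⟩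
      have := sq_le_two_mul_chainForm x n
      have hpos : 0 < x (n + 1 + 1) ^ 2 := by positivity
      rw [h0] at this ⊢
      linarith

theorem chainForm_single (n k : ℕ) (h1 : 1 ≤ k) (h2 : k ≤ n + 1) :
    ((Pi.single k 1 : ℕ → ℕ) (n + 1) : ℤ) ^ 2 +
      ∑ β ∈ Finset.Icc 1 n, (((Pi.single k 1 : ℕ → ℕ) β : ℤ) ^ 2 -
        ((Pi.single k 1 : ℕ → ℕ) β : ℤ) * ((Pi.single k 1 : ℕ → ℕ) (β + 1) : ℤ)) = 1 := by
  have hterm : ∀ β, (((Pi.single k 1 : ℕ → ℕ) β : ℤ) ^ 2 -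
      ((Pi.single k 1 : ℕ → ℕ) β : ℤ) * ((Pi.single k 1 : ℕ → ℕ) (β + 1) : ℤ)) =
      if β = k then 1 else 0 := by
    intro β
    by_cases h : β = k <;> simp [Pi.single_apply, h]
  rw [Finset.sum_congr rfl fun β _ => hterm β, Finset.sum_ite_eq', Pi.single_apply]
  simp only [Finset.mem_Icc]
  split_ifs <;> omega

/-- Combinatorial criterion for smallness of the resolution `ξ_p`: with
`m(ε) = Σ_β ε_β (ι_β - ι_{β-1} + λ_β - λ_{β+1}) + B(ε)` the codimension of the stratum
and `dG(ε) = Σ_β ε_β (λ_β - λ_{β+1})` the fibre dimension, one has `2·dG(ε) < m(ε)` for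
every nonzero tuple `ε` of natural numbers if and only if
`λ_β - λ_{β+1} ≤ ι_β - ι_{β-1}` for every `β = 1, …, ν`. -/
theorem xi_small_iff
    (ν : ℕ) (hν : 1 ≤ ν) (ι lam : ℕ → ℕ)
    (hι0 : ι 0 = 0)
    (hιlt : ∀ β, 1 ≤ β → β < ν → ι β < ι (β + 1))
    (hlam : ∀ β, 1 ≤ β → β < ν → lam (β + 1) ≤ lam β)
    (hlamend : lam (ν + 1) = 0) :
    (∀ ε : ℕ → ℕ, (∃ β, 1 ≤ β ∧ β ≤ ν ∧ ε β ≠ 0) →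
        2 * ∑ β ∈ Finset.Icc 1 ν, (ε β : ℤ) * ((lam β : ℤ) - (lam (β + 1) : ℤ)) <
          (∑ β ∈ Finset.Icc 1 ν, (ε β : ℤ) *
              ((ι β : ℤ) - (ι (β - 1) : ℤ) + (lam β : ℤ) - (lam (β + 1) : ℤ)))
            + ((ε ν : ℤ) ^ 2 +
                ∑ β ∈ Finset.Icc 1 (ν - 1), ((ε β : ℤ) ^ 2 - (ε β : ℤ) * (ε (β + 1) : ℤ)))) ↔
      ∀ β, 1 ≤ β → β ≤ ν →
        (lam β : ℤ) - (lam (β + 1) : ℤ) ≤ (ι β : ℤ) - (ι (β - 1) : ℤ) := by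
  obtain ⟨n, rfl⟩ : ∃ n, ν = n + 1 := ⟨ν - 1, by omega⟩
  rw [Nat.add_sub_cancel]
  constructor
  · intro h k h1 h2
    have hk := h (Pi.single k 1) ⟨k, h1, h2, by simp⟩
    rw [chainForm_single n k h1 h2] at hk
    have hsum : ∀ f : ℕ → ℤ,
        ∑ β ∈ Finset.Icc 1 (n + 1), ((Pi.single k 1 : ℕ → ℕ) β : ℤ) * f β = f k := by
      intro f
      simp [Pi.single_apply, h1, h2]
    rw [hsum fun β => (lam β : ℤ) - (lam (β + 1) : ℤ),
      hsum fun β => (ι β : ℤ) - (ι (β - 1) : ℤ) + (lam β : ℤ) - (lam (β + 1) : ℤ)] at hk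
    linarith
  · rintro h ε ⟨k, h1, h2, hk⟩
    have hB := sq_lt_two_mul_chainForm (fun β => (ε β : ℤ)) n ⟨k, h1, h2, by exact_mod_cast hk⟩
    have hle : 2 * ∑ β ∈ Finset.Icc 1 (n + 1), (ε β : ℤ) * ((lam β : ℤ) - (lam (β + 1) : ℤ)) ≤
        ∑ β ∈ Finset.Icc 1 (n + 1), (ε β : ℤ) *
          ((ι β : ℤ) - (ι (β - 1) : ℤ) + (lam β : ℤ) - (lam (β + 1) : ℤ)) := by
      rw [Finset.mul_sum]
      refine Finset.sum_le_sum fun β hβ => ?_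
      obtain ⟨hβ1, hβ2⟩ := Finset.mem_Icc.mp hβ
      nlinarith [mul_le_mul_of_nonneg_left (h β hβ1 hβ2) (Int.natCast_nonneg (ε β))]
    have hsq := sq_nonneg (ε (n + 1) : ℤ)
    linarith
end

section
/- Let ν ≥ 1, let ι_1 < ι_2 < … < ι_ν be natural numbers with ι_0 := 0, and let λ_1 ≥ λ_2 ≥ … ≥ λ_ν ≥ 0 be natural numbers with λ_{ν+1} := 0. For ε = (ε_1, …, ε_ν) a tuple of natural numbers define m(ε) := Σ_{β=1}^{ν} ε_β (ι_β − ι_{β−1} + λ_β − λ_{β+1}) + B(ε), where B(ε) := ε_ν² + Σ_{β=1}^{ν−1}(ε_β² − ε_β ε_{β+1}), and dF(ε) := Σ_{β=1}^{ν} ε_β (ι_β − ι_{β−1}). Then 2·dF(ε) < m(ε) holds for every nonzero tuple ε of natural numbers if and only if ι_β − ι_{β−1} ≤ λ_β − λ_{β+1} for every β = 1, …, ν. (This is the combinatorial criterion for smallness of the resolution π_p: m(ε) is the codimension of the stratum Δ_{p+ε} in Δ_p and dF(ε) is the dimension of the fibre F of π_p over it.) -/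
/-- The quadratic form of type `A` on `n + 1` variables dominates half the square of the last
variable, strictly so away from the origin. -/
theorem sq_le_two_mul_quadForm (ε : ℕ → ℤ) (n : ℕ) :
    ε (n + 1) ^ 2 ≤
        2 * (ε (n + 1) ^ 2 + ∑ β ∈ Finset.Icc 1 n, (ε β ^ 2 - ε β * ε (β + 1))) ∧
      ((∃ β, 1 ≤ β ∧ β ≤ n + 1 ∧ ε β ≠ 0) → ε (n + 1) ^ 2 <
        2 * (ε (n + 1) ^ 2 + ∑ β ∈ Finset.Icc 1 n, (ε β ^ 2 - ε β * ε (β + 1)))) := by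
  induction n with
  | zero =>
    simp only [Finset.Icc_eq_empty_of_lt zero_lt_one, Finset.sum_empty]
    refine ⟨by nlinarith [sq_nonneg (ε (0 + 1))], ?_⟩
    rintro ⟨β, h1, h2, h3⟩
    obtain rfl : β = 0 + 1 := by omega
    have := sq_pos_of_ne_zero h3
    linarith
  | succ n ih =>
    rw [Finset.sum_Icc_succ_top (by omega)]
    obtain ⟨hle, hlt⟩ := ih
    refine ⟨by nlinarith [sq_nonneg (ε (n + 1) - ε (n + 1 + 1))], ?_⟩
    rintro ⟨β, h1, h2, h3⟩
    by_cases h : ∃ β, 1 ≤ β ∧ β ≤ n + 1 ∧ ε β ≠ 0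
    · nlinarith [sq_nonneg (ε (n + 1) - ε (n + 1 + 1)), hlt h]
    · push Not at h
      have h0 : ε (n + 1) = 0 := h (n + 1) (by omega) le_rfl
      obtain rfl : β = n + 1 + 1 := by
        by_contra hne
        exact h3 (h β h1 (by omega))
      have := sq_pos_of_ne_zero h3
      rw [h0] at hle ⊢
      nlinarith

/-- The quadratic form of type `A` takes the value `1` on every standard basis vector. -/
theorem quadForm_single (b n : ℕ) (hb1 : 1 ≤ b) (hbn : b ≤ n) :
    (((if n = b then 1 else 0 : ℕ) : ℤ) ^ 2 + ∑ β ∈ Finset.Icc 1 (n - 1),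
      (((if β = b then 1 else 0 : ℕ) : ℤ) ^ 2 -
        ((if β = b then 1 else 0 : ℕ) : ℤ) * ((if β + 1 = b then 1 else 0 : ℕ) : ℤ))) = 1 := by
  have hterm : ∀ β ∈ Finset.Icc 1 (n - 1), (((if β = b then 1 else 0 : ℕ) : ℤ) ^ 2 -
      ((if β = b then 1 else 0 : ℕ) : ℤ) * ((if β + 1 = b then 1 else 0 : ℕ) : ℤ)) =
      if β = b then 1 else 0 := by
    intro β _
    by_cases h : β = b
    · subst h
      simp
    · simp [h]
  rw [Finset.sum_congr rfl hterm, Finset.sum_ite_eq']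
  by_cases h : n = b
  · have : b ∉ Finset.Icc 1 (n - 1) := by
      rw [Finset.mem_Icc]
      omega
    simp [h] at this ⊢
    omega
  · have : b ∈ Finset.Icc 1 (n - 1) := by
      rw [Finset.mem_Icc]
      omega
    rw [if_pos this]
    simp [h]


/-- Combinatorial criterion for smallness of the resolution `π_p`: with
`m(ε) = Σ_β ε_β (ι_β - ι_{β-1} + λ_β - λ_{β+1}) + B(ε)` the codimension of the stratum
and `dF(ε) = Σ_β ε_β (ι_β - ι_{β-1})` the fibre dimension, one has `2·dF(ε) < m(ε)` for
every nonzero tuple `ε` of natural numbers if and only if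
`ι_β - ι_{β-1} ≤ λ_β - λ_{β+1}` for every `β = 1, …, ν`. -/
theorem pi_small_iff
    (ν : ℕ) (hν : 1 ≤ ν) (ι lam : ℕ → ℕ)
    (hι0 : ι 0 = 0)
    (hιlt : ∀ β, 1 ≤ β → β < ν → ι β < ι (β + 1))
    (hlam : ∀ β, 1 ≤ β → β < ν → lam (β + 1) ≤ lam β)
    (hlamend : lam (ν + 1) = 0) :
    (∀ ε : ℕ → ℕ, (∃ β, 1 ≤ β ∧ β ≤ ν ∧ ε β ≠ 0) →
        2 * ∑ β ∈ Finset.Icc 1 ν, (ε β : ℤ) * ((ι β : ℤ) - (ι (β - 1) : ℤ)) <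
          (∑ β ∈ Finset.Icc 1 ν, (ε β : ℤ) *
              ((ι β : ℤ) - (ι (β - 1) : ℤ) + (lam β : ℤ) - (lam (β + 1) : ℤ)))
            + ((ε ν : ℤ) ^ 2 +
                ∑ β ∈ Finset.Icc 1 (ν - 1), ((ε β : ℤ) ^ 2 - (ε β : ℤ) * (ε (β + 1) : ℤ)))) ↔
      ∀ β, 1 ≤ β → β ≤ ν →
        (ι β : ℤ) - (ι (β - 1) : ℤ) ≤ (lam β : ℤ) - (lam (β + 1) : ℤ) := by
  constructor
  · intro H b hb1 hbν
    have hsum : ∀ f : ℕ → ℤ,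
        ∑ β ∈ Finset.Icc 1 ν, ((if β = b then 1 else 0 : ℕ) : ℤ) * f β = f b := by
      intro f
      simp [hb1, hbν]
    have h := H (fun β => if β = b then 1 else 0) ⟨b, hb1, hbν, by simp⟩
    beta_reduce at h
    rw [quadForm_single b ν hb1 hbν, hsum (fun β => (ι β : ℤ) - (ι (β - 1) : ℤ)),
      hsum (fun β => (ι β : ℤ) - (ι (β - 1) : ℤ) + (lam β : ℤ) - (lam (β + 1) : ℤ))] at h
    linarith
  · rintro H ε ⟨b, hb1, hbν, hb⟩
    have hB := (sq_le_two_mul_quadForm (fun β => (ε β : ℤ)) (ν - 1)).2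
      ⟨b, hb1, by omega, by exact_mod_cast hb⟩
    rw [Nat.sub_add_cancel hν] at hB
    have hL : 2 * ∑ β ∈ Finset.Icc 1 ν, (ε β : ℤ) * ((ι β : ℤ) - (ι (β - 1) : ℤ)) ≤
        ∑ β ∈ Finset.Icc 1 ν, (ε β : ℤ) *
          ((ι β : ℤ) - (ι (β - 1) : ℤ) + (lam β : ℤ) - (lam (β + 1) : ℤ)) := by
      rw [Finset.mul_sum]
      refine Finset.sum_le_sum fun β hβ => ?_
      rw [Finset.mem_Icc] at hβ
      nlinarith [mul_le_mul_of_nonneg_left (H β hβ.1 hβ.2) (Int.natCast_nonneg (ε β))]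
    have := sq_nonneg (ε ν : ℤ)
    linarith
end
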